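/- Let K and ΔK be symmetric (m+n)×(m+n) real matrices, let ε ≥ 0, and let L̃ be an (m+n)×(m+n) lower triangular real matrix with positive diagonal entries such that K + ΔK = L̃·J_{m+n}·L̃ᵀ, |ΔK| ≤ ε·|L̃|·|L̃ᵀ| entrywise, and cond_F(L̃) · cond_F(L̃⁻ᵀ) · ε < 1/2. If ΔL is a matrix such that L̃ − ΔL is lower triangular with positive diagonal entries and K = (L̃ − ΔL)·J_{m+n}·(L̃ − ΔL)ᵀ, then for every (m+n)×(m+n) diagonal matrix D with positive diagonal entries, ‖ΔL‖_F ≤ √2 · ‖L̃·D⁻¹‖₂ · ‖D·|L̃⁻¹|·|L̃|‖₂ · cond_F(L̃) · ε / (√2 − 1 + √(1 − 2·cond_F(L̃)·cond_F(L̃⁻ᵀ)·ε)). -/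

import Mathlib

open Matrix

noncomputable def frobNorm {k : ℕ} (A : Matrix (Fin k) (Fin k) ℝ) : ℝ :=
  Real.sqrt (∑ i, ∑ j, (A i j) ^ 2)

noncomputable def specNorm {k : ℕ} (A : Matrix (Fin k) (Fin k) ℝ) : ℝ :=
  ‖Matrix.toEuclideanCLM (𝕜 := ℝ) A‖

noncomputable def kappa2 {k : ℕ} (A : Matrix (Fin k) (Fin k) ℝ) : ℝ :=
  specNorm A⁻¹ * specNorm A

noncomputable def upTri {k : ℕ} (A : Matrix (Fin k) (Fin k) ℝ) : Matrix (Fin k) (Fin k) ℝ :=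
  Matrix.of fun i j => if i < j then A i j else if i = j then A i i / 2 else 0

noncomputable def Jmat (m n : ℕ) : Matrix (Fin (m + n)) (Fin (m + n)) ℝ :=
  Matrix.diagonal fun i => if (i : ℕ) < m then 1 else -1

def IsLowerTri {k : ℕ} (A : Matrix (Fin k) (Fin k) ℝ) : Prop :=
  ∀ i j, i < j → A i j = 0

def IsUpperTri {k : ℕ} (A : Matrix (Fin k) (Fin k) ℝ) : Prop :=
  ∀ i j, j < i → A i j = 0

def PosDiag {k : ℕ} (A : Matrix (Fin k) (Fin k) ℝ) : Prop :=
  ∀ i, 0 < A i i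

noncomputable def entAbs {k : ℕ} (A : Matrix (Fin k) (Fin k) ℝ) : Matrix (Fin k) (Fin k) ℝ :=
  Matrix.of fun i j => |A i j|

noncomputable def condF {k : ℕ} (A : Matrix (Fin k) (Fin k) ℝ) : ℝ :=
  frobNorm (entAbs A⁻¹ * entAbs A)

section GeneralizedCholesky

open scoped Matrix.Norms.Frobenius

variable {k : ℕ}

lemma norm_sq_eq_sum (A : Matrix (Fin k) (Fin k) ℝ) : ‖A‖ ^ 2 = ∑ i, ∑ j, (A i j) ^ 2 := by
  have h : 0 ≤ ∑ i, ∑ j, (A i j) ^ 2 := by positivity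
  rw [Matrix.frobenius_norm_def, ← Real.sqrt_eq_rpow]
  simp only [Real.rpow_two, Real.norm_eq_abs, sq_abs]
  exact Real.sq_sqrt h

lemma frobNorm_eq_norm (A : Matrix (Fin k) (Fin k) ℝ) : frobNorm A = ‖A‖ := by
  rw [frobNorm, ← norm_sq_eq_sum, Real.sqrt_sq (norm_nonneg A)]

lemma norm_le_norm_of_abs_le {A B : Matrix (Fin k) (Fin k) ℝ} (h : ∀ i j, |A i j| ≤ B i j) :
    ‖A‖ ≤ ‖B‖ := by
  rw [← sq_le_sq₀ (norm_nonneg _) (norm_nonneg _), norm_sq_eq_sum, norm_sq_eq_sum]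
  refine Finset.sum_le_sum fun i _ => Finset.sum_le_sum fun j _ => ?_
  exact sq_le_sq.2 ((h i j).trans (le_abs_self _))

lemma abs_apply_le_norm (A : Matrix (Fin k) (Fin k) ℝ) (i j : Fin k) : |A i j| ≤ ‖A‖ := by
  rw [← Real.sqrt_sq_eq_abs, ← Real.sqrt_sq (norm_nonneg A)]
  refine Real.sqrt_le_sqrt ?_
  rw [norm_sq_eq_sum]
  calc (A i j) ^ 2 ≤ ∑ j, (A i j) ^ 2 :=
        Finset.single_le_sum (f := fun j => (A i j) ^ 2) (fun _ _ => sq_nonneg _)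
          (Finset.mem_univ j)
    _ ≤ ∑ i, ∑ j, (A i j) ^ 2 :=
        Finset.single_le_sum (f := fun i => ∑ j, (A i j) ^ 2) (fun _ _ => by positivity)
          (Finset.mem_univ i)

lemma norm_mul_le_specNorm_mul (A B : Matrix (Fin k) (Fin k) ℝ) :
    ‖A * B‖ ≤ specNorm A * ‖B‖ := by
  have hs : 0 ≤ specNorm A := norm_nonneg _
  rw [← sq_le_sq₀ (norm_nonneg _) (by positivity), mul_pow, norm_sq_eq_sum, norm_sq_eq_sum,
    Finset.sum_comm, Finset.sum_comm (f := fun i j => (B i j) ^ 2), Finset.mul_sum]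
  refine Finset.sum_le_sum fun j _ => ?_
  have h := (Matrix.toEuclideanCLM (𝕜 := ℝ) A).le_opNorm (WithLp.toLp 2 fun i => B i j)
  have h2 := pow_le_pow_left₀ (norm_nonneg _) h 2
  rw [mul_pow, EuclideanSpace.real_norm_sq_eq, EuclideanSpace.real_norm_sq_eq] at h2
  exact h2

/-- The lower triangular part of a matrix, with the diagonal halved. -/
noncomputable def halfLower (A : Matrix (Fin k) (Fin k) ℝ) : Matrix (Fin k) (Fin k) ℝ :=
  Matrix.of fun i j => if j < i then A i j else if i = j then A i i / 2 else 0

lemma isLowerTri_halfLower (A : Matrix (Fin k) (Fin k) ℝ) : IsLowerTri (halfLower A) := by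
  intro i j hij
  simp [halfLower, hij.not_gt, hij.ne]

lemma halfLower_sub (A B : Matrix (Fin k) (Fin k) ℝ) :
    halfLower (A - B) = halfLower A - halfLower B := by
  ext i j
  simp only [halfLower, Matrix.of_apply, Matrix.sub_apply]
  split_ifs <;> ring

lemma diagonal_mul_halfLower (d : Fin k → ℝ) (A : Matrix (Fin k) (Fin k) ℝ) :
    Matrix.diagonal d * halfLower A = halfLower (Matrix.diagonal d * A) := by
  ext i j
  simp only [halfLower, Matrix.of_apply, Matrix.diagonal_mul]
  split_ifs <;> ring

lemma halfLower_add_transpose {S : Matrix (Fin k) (Fin k) ℝ} (hS : Sᵀ = S) :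
    halfLower S + (halfLower S)ᵀ = S := by
  ext i j
  have hij : S j i = S i j := congrFun (congrFun hS i) j
  simp only [halfLower, Matrix.of_apply, Matrix.add_apply, Matrix.transpose_apply]
  rcases lt_trichotomy i j with h | h | h
  · simp [h, h.not_gt, h.ne, hij]
  · simp [h]
  · simp [h, h.not_gt, h.ne]

lemma norm_halfLower_le (A : Matrix (Fin k) (Fin k) ℝ) : ‖halfLower A‖ ≤ ‖A‖ := by
  rw [← sq_le_sq₀ (norm_nonneg _) (norm_nonneg _), norm_sq_eq_sum, norm_sq_eq_sum]
  refine Finset.sum_le_sum fun i _ => Finset.sum_le_sum fun j _ => ?_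
  simp only [halfLower, Matrix.of_apply]
  split_ifs with h1 h2
  · rfl
  · subst h2; nlinarith [sq_nonneg (A i i)]
  · rw [zero_pow two_ne_zero]; positivity

lemma sqrt_two_mul_norm_halfLower_le {S : Matrix (Fin k) (Fin k) ℝ} (hS : Sᵀ = S) :
    √2 * ‖halfLower S‖ ≤ ‖S‖ := by
  rw [← sq_le_sq₀ (mul_nonneg (Real.sqrt_nonneg _) (norm_nonneg _)) (norm_nonneg _), mul_pow,
    Real.sq_sqrt (by norm_num), two_mul]
  conv_lhs => rw [← Matrix.frobenius_norm_transpose (halfLower S)]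
  nth_rewrite 2 [Matrix.frobenius_norm_transpose]
  simp only [norm_sq_eq_sum, ← Finset.sum_add_distrib]
  refine Finset.sum_le_sum fun i _ => Finset.sum_le_sum fun j _ => ?_
  have hij : S j i = S i j := congrFun (congrFun hS i) j
  simp only [halfLower, Matrix.of_apply, Matrix.transpose_apply]
  rcases lt_trichotomy i j with h | h | h
  · simp [h, h.not_gt, h.ne, hij]
  · subst h; simp; nlinarith [sq_nonneg (S i i)]
  · simp [h, h.not_gt, h.ne]

lemma norm_mul_sign (A : Matrix (Fin k) (Fin k) ℝ) {s : Fin k → ℝ} (hs : ∀ i, s i ^ 2 = 1) :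
    ‖A * Matrix.diagonal s‖ = ‖A‖ := by
  rw [← sq_eq_sq₀ (norm_nonneg _) (norm_nonneg _), norm_sq_eq_sum, norm_sq_eq_sum]
  simp [Matrix.mul_diagonal, mul_pow, hs]

lemma diagonal_sign_mul_self {s : Fin k → ℝ} (hs : ∀ i, s i ^ 2 = 1) :
    Matrix.diagonal s * Matrix.diagonal s = 1 := by
  rw [Matrix.diagonal_mul_diagonal, ← Matrix.diagonal_one]
  congr 1
  ext i
  rw [← sq, hs]

lemma transpose_mul_diagonal_mul_transpose (X : Matrix (Fin k) (Fin k) ℝ) (s : Fin k → ℝ) :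
    (X * Matrix.diagonal s * Xᵀ)ᵀ = X * Matrix.diagonal s * Xᵀ := by
  simp [Matrix.transpose_mul, Matrix.mul_assoc]

lemma norm_mul_sign_mul_transpose_le (X Y : Matrix (Fin k) (Fin k) ℝ) {s : Fin k → ℝ}
    (hs : ∀ i, s i ^ 2 = 1) : ‖X * Matrix.diagonal s * Yᵀ‖ ≤ ‖X‖ * ‖Y‖ := by
  refine (Matrix.frobenius_norm_mul _ _).trans ?_
  rw [norm_mul_sign X hs, Matrix.frobenius_norm_transpose]

/-- The equation `X J + (X J)ᵀ = M + X J Xᵀ` has a small solution with `X J` lower triangular. -/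
lemma exists_small_solution {M : Matrix (Fin k) (Fin k) ℝ} (hM : Mᵀ = M) {b : ℝ}
    (hMb : ‖M‖ ≤ b) (hb : b < 1 / 2) {s : Fin k → ℝ} (hs : ∀ i, s i ^ 2 = 1) :
    ∃ X : Matrix (Fin k) (Fin k) ℝ,
      X * Matrix.diagonal s = halfLower (M + X * Matrix.diagonal s * Xᵀ) ∧
      √2 * ‖X‖ ≤ 1 - √(1 - 2 * b) := by
  set J := Matrix.diagonal s with hJ
  have hJJ : J * J = 1 := diagonal_sign_mul_self hs
  have h2 : √2 * √2 = 2 := Real.mul_self_sqrt (by norm_num)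
  have h2pos : 0 < √2 := by positivity
  have hb0 : 0 ≤ b := (norm_nonneg M).trans hMb
  set w := √(1 - 2 * b) with hw
  have hww : w * w = 1 - 2 * b := Real.mul_self_sqrt (by linarith)
  have hwpos : 0 < w := Real.sqrt_pos.2 (by linarith)
  have hw1 : w ≤ 1 := Real.sqrt_le_one.2 (by linarith)
  set r := (1 - w) / √2 with hr
  have hr2 : √2 * r = 1 - w := by rw [hr]; field_simp
  have hr0 : 0 ≤ r := div_nonneg (by linarith) h2pos.le
  have hrr : b + r * r = √2 * r := by nlinarith
  set Φ : Matrix (Fin k) (Fin k) ℝ → Matrix (Fin k) (Fin k) ℝ :=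
    fun X => halfLower (M + X * J * Xᵀ) * J with hΦ
  have hmaps : Set.MapsTo Φ (Metric.closedBall 0 r) (Metric.closedBall 0 r) := by
    intro X hX
    rw [mem_closedBall_zero_iff] at hX ⊢
    have hsym : (M + X * J * Xᵀ)ᵀ = M + X * J * Xᵀ := by
      rw [Matrix.transpose_add, hM, transpose_mul_diagonal_mul_transpose]
    have h := sqrt_two_mul_norm_halfLower_le hsym
    have h' : ‖M + X * J * Xᵀ‖ ≤ b + r * r := (norm_add_le _ _).trans
      (add_le_add hMb ((norm_mul_sign_mul_transpose_le X X hs).trans (by gcongr)))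
    rw [hΦ]
    dsimp only
    rw [norm_mul_sign _ hs]
    exact le_of_mul_le_mul_left (by linarith) h2pos
  have hlip : ContractingWith (1 - w).toNNReal (hmaps.restrict Φ _ _) := by
    refine ⟨?_, LipschitzWith.of_dist_le_mul fun X Y => ?_⟩
    · rw [← NNReal.coe_lt_coe, Real.coe_toNNReal _ (sub_nonneg.2 hw1), NNReal.coe_one]
      linarith
    · obtain ⟨X, hX⟩ := X
      obtain ⟨Y, hY⟩ := Y
      rw [mem_closedBall_zero_iff] at hX hY
      simp only [Subtype.dist_eq, Set.MapsTo.val_restrict_apply, dist_eq_norm, 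
        Real.coe_toNNReal _ (sub_nonneg.2 hw1), hΦ]
      rw [← Matrix.sub_mul, norm_mul_sign _ hs, ← halfLower_sub, add_sub_add_left_eq_sub]
      have hsym : (X * J * Xᵀ - Y * J * Yᵀ)ᵀ = X * J * Xᵀ - Y * J * Yᵀ := by
        rw [Matrix.transpose_sub, transpose_mul_diagonal_mul_transpose,
          transpose_mul_diagonal_mul_transpose]
      have h := sqrt_two_mul_norm_halfLower_le hsym
      have hsplit : X * J * Xᵀ - Y * J * Yᵀ = X * J * (X - Y)ᵀ + (X - Y) * J * Yᵀ := by
        rw [Matrix.transpose_sub]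
        noncomm_ring
      have h' : ‖X * J * Xᵀ - Y * J * Yᵀ‖ ≤ r * ‖X - Y‖ + ‖X - Y‖ * r := by
        rw [hsplit]
        refine (norm_add_le _ _).trans (add_le_add
          ((norm_mul_sign_mul_transpose_le _ _ hs).trans ?_)
          ((norm_mul_sign_mul_transpose_le _ _ hs).trans ?_)) <;> gcongr
      rw [← hr2]
      refine le_of_mul_le_mul_left ?_ h2pos
      calc _ ≤ 2 * r * ‖X - Y‖ := by linarith
        _ = √2 * √2 * r * ‖X - Y‖ := by rw [h2]
        _ = _ := by ring
  obtain ⟨X, hX, hfix, -⟩ := hlip.exists_fixedPoint' Metric.isClosed_closedBall.isComplete hmaps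
    (Metric.mem_closedBall_self hr0) (edist_ne_top _ _)
  refine ⟨X, ?_, ?_⟩
  · have hfix' : halfLower (M + X * J * Xᵀ) * J = X := hfix
    nth_rewrite 1 [← hfix']
    rw [Matrix.mul_assoc, hJJ, Matrix.mul_one]
  · rw [mem_closedBall_zero_iff] at hX
    rw [← hr2]
    gcongr

lemma IsLowerTri.blockTriangular {A : Matrix (Fin k) (Fin k) ℝ} (hA : IsLowerTri A) :
    A.BlockTriangular OrderDual.toDual :=
  fun i j hij => hA i j hij

lemma IsLowerTri.mul {A B : Matrix (Fin k) (Fin k) ℝ} (hA : IsLowerTri A) (hB : IsLowerTri B) :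
    IsLowerTri (A * B) :=
  fun i j hij => (hA.blockTriangular.mul hB.blockTriangular) (i := i) (j := j) hij

lemma IsLowerTri.mul_apply_self {A B : Matrix (Fin k) (Fin k) ℝ} (hA : IsLowerTri A)
    (hB : IsLowerTri B) (i : Fin k) : (A * B) i i = A i i * B i i := by
  rw [Matrix.mul_apply]
  refine Finset.sum_eq_single i (fun j _ hj => ?_) (by simp)
  rcases lt_or_gt_of_ne hj with h | h
  · rw [hB j i h, mul_zero]
  · rw [hA i j h, zero_mul]

lemma IsLowerTri.isUnit_det {A : Matrix (Fin k) (Fin k) ℝ} (hA : IsLowerTri A)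
    (hd : PosDiag A) : IsUnit A.det := by
  rw [Matrix.det_of_isLowerTriangular A hA.blockTriangular, isUnit_iff_ne_zero]
  exact (Finset.prod_pos fun i _ => hd i).ne'

lemma IsLowerTri.inv {A : Matrix (Fin k) (Fin k) ℝ} (hA : IsLowerTri A)
    (hu : IsUnit A.det) : IsLowerTri A⁻¹ := by
  have : Invertible A := Matrix.invertibleOfIsUnitDet A hu
  intro i j hij
  exact Matrix.blockTriangular_inv_of_blockTriangular hA.blockTriangular (i := i) (j := j) hij

/-- A lower triangular `Z` with positive diagonal and `Z J Zᵀ = J` is the identity. -/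
lemma IsLowerTri.eq_one_of_mul_sign_mul_transpose {Z : Matrix (Fin k) (Fin k) ℝ}
    (hZ : IsLowerTri Z) (hZd : PosDiag Z) {s : Fin k → ℝ} (hs : ∀ i, s i ^ 2 = 1)
    (h : Z * Matrix.diagonal s * Zᵀ = Matrix.diagonal s) : Z = 1 := by
  have hs0 : ∀ i, s i ≠ 0 := fun i hi => by simpa [hi] using hs i
  have hinv : Z⁻¹ = Matrix.diagonal s * Zᵀ * Matrix.diagonal s := by
    refine Matrix.inv_eq_right_inv ?_
    rw [← diagonal_sign_mul_self hs, ← Matrix.mul_assoc, ← Matrix.mul_assoc, h]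
  have hoff : ∀ i j, j < i → Z i j = 0 := by
    intro i j hij
    have h0 := hZ.inv (hZ.isUnit_det hZd) j i hij
    rw [hinv, Matrix.mul_diagonal, Matrix.diagonal_mul, Matrix.transpose_apply] at h0
    simpa [hs0] using h0
  have hdiag : Z = Matrix.diagonal fun i => Z i i := by
    ext i j
    rcases lt_trichotomy i j with hij | hij | hij
    · rw [hZ i j hij, Matrix.diagonal_apply_ne _ hij.ne]
    · subst hij; simp
    · rw [hoff i j hij, Matrix.diagonal_apply_ne _ hij.ne']
  rw [hdiag, ← Matrix.diagonal_one]
  congr 1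
  ext i
  rw [hdiag, Matrix.diagonal_transpose, Matrix.diagonal_mul_diagonal,
    Matrix.diagonal_mul_diagonal] at h
  have hi := congrFun (Matrix.diagonal_injective h) i
  have h1 : Z i i * Z i i = 1 := mul_right_cancel₀ (hs0 i) (by linarith)
  nlinarith [hZd i]

lemma generalizedCholesky_unique {P Q : Matrix (Fin k) (Fin k) ℝ}
    (hP : IsLowerTri P) (hPd : PosDiag P) (hQ : IsLowerTri Q) (hQd : PosDiag Q)
    {s : Fin k → ℝ} (hs : ∀ i, s i ^ 2 = 1)
    (h : P * Matrix.diagonal s * Pᵀ = Q * Matrix.diagonal s * Qᵀ) : P = Q := by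
  have hu := hQ.isUnit_det hQd
  have hut : IsUnit Qᵀ.det := by rwa [Matrix.det_transpose]
  have hZ : IsLowerTri (Q⁻¹ * P) := (hQ.inv hu).mul hP
  have hQZ : Q * (Q⁻¹ * P) = P := Matrix.mul_nonsing_inv_cancel_left Q P hu
  have hZd : PosDiag (Q⁻¹ * P) := by
    intro i
    have hi := hQ.mul_apply_self hZ i
    rw [hQZ] at hi
    exact pos_of_mul_pos_right (hi ▸ hPd i) (hQd i).le
  have hone : Q⁻¹ * P = 1 := by
    refine hZ.eq_one_of_mul_sign_mul_transpose hZd hs ?_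
    calc Q⁻¹ * P * Matrix.diagonal s * (Q⁻¹ * P)ᵀ
        = Q⁻¹ * (P * Matrix.diagonal s * Pᵀ) * (Qᵀ)⁻¹ := by
          rw [Matrix.transpose_mul, Matrix.transpose_nonsing_inv]
          simp only [Matrix.mul_assoc]
      _ = (Q⁻¹ * Q) * Matrix.diagonal s * (Qᵀ * (Qᵀ)⁻¹) := by
          rw [h]
          simp only [Matrix.mul_assoc]
      _ = Matrix.diagonal s := by
          rw [Matrix.nonsing_inv_mul _ hu, Matrix.mul_nonsing_inv _ hut, Matrix.one_mul,
            Matrix.mul_one]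
  rw [← hQZ, hone, Matrix.mul_one]

lemma condF_inv_transpose {A : Matrix (Fin k) (Fin k) ℝ} (hA : IsUnit A.det) :
    condF (A⁻¹ᵀ) = condF A := by
  have h : entAbs (A⁻¹ᵀ)⁻¹ * entAbs A⁻¹ᵀ = (entAbs A⁻¹ * entAbs A)ᵀ := by
    rw [← Matrix.transpose_nonsing_inv, Matrix.nonsing_inv_nonsing_inv A hA, Matrix.transpose_mul]
    rfl
  rw [condF, condF, h, frobNorm_eq_norm, frobNorm_eq_norm, Matrix.frobenius_norm_transpose]

lemma abs_mul_apply_le {A B A' B' : Matrix (Fin k) (Fin k) ℝ} (hA : ∀ i j, |A i j| ≤ A' i j)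
    (hB : ∀ i j, |B i j| ≤ B' i j) (i j : Fin k) : |(A * B) i j| ≤ (A' * B') i j := by
  rw [Matrix.mul_apply, Matrix.mul_apply]
  refine (Finset.abs_sum_le_sum_abs _ _).trans (Finset.sum_le_sum fun l _ => ?_)
  rw [abs_mul]
  exact mul_le_mul (hA i l) (hB l j) (abs_nonneg _) ((abs_nonneg _).trans (hA i l))

/-- Componentwise perturbation bound for the generalized Cholesky factorization. -/
theorem norm_generalizedCholesky_perturbation_le {K dK L dL : Matrix (Fin k) (Fin k) ℝ}
    {s d : Fin k → ℝ} {ε : ℝ} (hs : ∀ i, s i ^ 2 = 1) (hdK : dKᵀ = dK) (hε : 0 ≤ ε)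
    (hL : IsLowerTri L) (hLd : PosDiag L) (hfact : K + dK = L * Matrix.diagonal s * Lᵀ)
    (hbound : ∀ i j, |dK i j| ≤ ε * (entAbs L * entAbs Lᵀ) i j)
    (hsmall : condF L * condF L * ε < 1 / 2)
    (hL' : IsLowerTri (L - dL)) (hL'd : PosDiag (L - dL))
    (hfact' : K = (L - dL) * Matrix.diagonal s * (L - dL)ᵀ) (hd : ∀ i, 0 < d i) :
    frobNorm dL ≤
      √2 * specNorm (L * (Matrix.diagonal d)⁻¹) *
        specNorm (Matrix.diagonal d * (entAbs L⁻¹ * entAbs L)) * condF L * ε /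
        (√2 - 1 + √(1 - 2 * (condF L * condF L * ε))) := by
  set J := Matrix.diagonal s with hJdef
  have hJJ : J * J = 1 := diagonal_sign_mul_self hs
  have hu := hL.isUnit_det hLd
  have hut : IsUnit Lᵀ.det := by rwa [Matrix.det_transpose]
  set B := entAbs L⁻¹ * entAbs L with hB
  have hc : condF L = ‖B‖ := by rw [condF, frobNorm_eq_norm]
  rw [hc, frobNorm_eq_norm]
  rw [hc] at hsmall
  set M := L⁻¹ * dK * L⁻¹ᵀ with hMdef
  have hM : Mᵀ = M := by
    simp [hMdef, Matrix.transpose_mul, hdK, Matrix.mul_assoc]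
  have hLM : L * M * Lᵀ = dK := by
    rw [hMdef, Matrix.transpose_nonsing_inv]
    calc L * (L⁻¹ * dK * (Lᵀ)⁻¹) * Lᵀ = (L * L⁻¹) * dK * ((Lᵀ)⁻¹ * Lᵀ) := by
          simp only [Matrix.mul_assoc]
      _ = dK := by
          rw [Matrix.mul_nonsing_inv _ hu, Matrix.nonsing_inv_mul _ hut, Matrix.one_mul,
            Matrix.mul_one]
  have hMabs : ∀ i j, |M i j| ≤ (ε • (B * Bᵀ)) i j := by
    have h1 : ∀ i j, |dK i j| ≤ (ε • (entAbs L * entAbs Lᵀ)) i j := hbound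
    have h2 := abs_mul_apply_le (abs_mul_apply_le (A := L⁻¹) (A' := entAbs L⁻¹)
      (fun _ _ => le_rfl) h1) (B := L⁻¹ᵀ) (B' := (entAbs L⁻¹)ᵀ) (fun _ _ => le_rfl)
    have h3 : entAbs L⁻¹ * (ε • (entAbs L * entAbs Lᵀ)) * (entAbs L⁻¹)ᵀ = ε • (B * Bᵀ) := by
      have h4 : entAbs Lᵀ = (entAbs L)ᵀ := rfl
      rw [hB, h4, Matrix.transpose_mul, Matrix.mul_smul, Matrix.smul_mul]
      simp only [Matrix.mul_assoc]
    rwa [h3] at h2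
  have hMb : ‖M‖ ≤ ‖B‖ * ‖B‖ * ε := by
    refine (norm_le_norm_of_abs_le hMabs).trans ?_
    rw [norm_smul, Real.norm_of_nonneg hε, mul_comm]
    gcongr
    exact (Matrix.frobenius_norm_mul _ _).trans_eq (by rw [Matrix.frobenius_norm_transpose])
  obtain ⟨X, hX, hXn⟩ := exists_small_solution hM hMb hsmall hs
  rw [← hJdef] at hX
  have hsym : (M + X * J * Xᵀ)ᵀ = M + X * J * Xᵀ := by
    rw [Matrix.transpose_add, hM, transpose_mul_diagonal_mul_transpose]
  have hXeq : X * J + (X * J)ᵀ = M + X * J * Xᵀ := by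
    conv_lhs => rw [hX]
    exact halfLower_add_transpose hsym
  have hXlow : IsLowerTri X := by
    have h : X = X * J * J := by rw [Matrix.mul_assoc, hJJ, Matrix.mul_one]
    rw [h, hX]
    intro i j hij
    rw [hJdef, Matrix.mul_diagonal, isLowerTri_halfLower _ i j hij, zero_mul]
  set w := √(1 - 2 * (‖B‖ * ‖B‖ * ε)) with hw
  have hw0 : 0 ≤ w := Real.sqrt_nonneg _
  have hsqrt : 1 < √2 := Real.lt_sqrt_of_sq_lt (by norm_num)
  have hX1 : ‖X‖ < 1 := by nlinarith [norm_nonneg X]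
  have hYlow : IsLowerTri (1 - X) := by
    intro i j hij
    rw [Matrix.sub_apply, Matrix.one_apply_ne hij.ne, hXlow i j hij, sub_zero]
  have hYd : PosDiag (1 - X) := by
    intro i
    rw [Matrix.sub_apply, Matrix.one_apply_eq]
    linarith [le_abs_self (X i i), abs_apply_le_norm X i i]
  have hYeq : (1 - X) * J * (1 - X)ᵀ = J - M := by
    have hJt : Jᵀ = J := Matrix.diagonal_transpose s
    rw [Matrix.transpose_mul, hJt] at hXeq
    rw [Matrix.transpose_sub, Matrix.transpose_one, eq_sub_of_add_eq hXeq.symm]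
    noncomm_ring
  have hdL : L - dL = L * (1 - X) := by
    refine generalizedCholesky_unique hL' hL'd (hL.mul hYlow) (fun i => ?_) hs ?_
    · rw [hL.mul_apply_self hYlow]
      exact mul_pos (hLd i) (hYd i)
    · rw [← hJdef, ← hfact', eq_sub_of_add_eq hfact, Matrix.transpose_mul]
      calc L * J * Lᵀ - dK = L * (J - M) * Lᵀ := by
            rw [Matrix.mul_sub, Matrix.sub_mul, hLM]
        _ = _ := by
            rw [← hYeq]
            simp only [Matrix.mul_assoc]
  have hdL' : dL = L * X := by
    rw [Matrix.mul_sub, Matrix.mul_one] at hdL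
    exact sub_right_injective hdL
  set D := Matrix.diagonal d with hD
  have hDu : IsUnit D.det := by
    rw [hD, Matrix.det_diagonal, isUnit_iff_ne_zero]
    exact (Finset.prod_pos fun i _ => hd i).ne'
  have hdLn : ‖dL‖ ≤ specNorm (L * D⁻¹) * ‖D * X‖ := by
    have h : dL = (L * D⁻¹) * (D * X) := by
      rw [hdL', Matrix.mul_assoc, Matrix.nonsing_inv_mul_cancel_left _ _ hDu]
    rw [h]
    exact norm_mul_le_specNorm_mul _ _
  have hDabs : ∀ i j, |D i j| ≤ D i j := by
    intro i j
    refine (abs_of_nonneg ?_).le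
    rw [hD, Matrix.diagonal_apply]
    split_ifs
    · exact (hd i).le
    · exact le_rfl
  have hDM : ‖D * M‖ ≤ specNorm (D * B) * ‖B‖ * ε := by
    refine (norm_le_norm_of_abs_le (abs_mul_apply_le hDabs hMabs)).trans ?_
    rw [Matrix.mul_smul, norm_smul, Real.norm_of_nonneg hε, mul_comm, ← Matrix.mul_assoc]
    gcongr
    exact (norm_mul_le_specNorm_mul _ _).trans_eq (by rw [Matrix.frobenius_norm_transpose])
  have hDX : ‖D * X‖ ≤ specNorm (D * B) * ‖B‖ * ε + ‖D * X‖ * ‖X‖ := by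
    calc ‖D * X‖ = ‖halfLower (D * M + (D * X) * J * Xᵀ)‖ := by
          have h : D * X * J = halfLower (D * M + D * X * J * Xᵀ) := by
            calc D * X * J = D * (X * J) := Matrix.mul_assoc _ _ _
              _ = D * halfLower (M + X * J * Xᵀ) := by rw [← hX]
              _ = _ := by
                rw [hD, diagonal_mul_halfLower, Matrix.mul_add]
                simp only [Matrix.mul_assoc]
          rw [← h, hJdef, norm_mul_sign _ hs]
      _ ≤ ‖D * M‖ + ‖(D * X) * J * Xᵀ‖ := (norm_halfLower_le _).trans (norm_add_le _ _)
      _ ≤ _ := add_le_add hDM (norm_mul_sign_mul_transpose_le _ _ hs)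
  have hden : 0 < √2 - 1 + w := by linarith
  rw [le_div_iff₀ hden]
  have hspec : 0 ≤ specNorm (L * D⁻¹) := norm_nonneg _
  have hfin : ‖D * X‖ * (√2 - 1 + w) ≤ √2 * (specNorm (D * B) * ‖B‖ * ε) := by
    calc ‖D * X‖ * (√2 - 1 + w) ≤ ‖D * X‖ * (√2 - √2 * ‖X‖) := by
          gcongr
          linarith
      _ = √2 * (‖D * X‖ - ‖D * X‖ * ‖X‖) := by ring
      _ ≤ _ := by
          gcongr
          linarith
  calc ‖dL‖ * (√2 - 1 + w) ≤ specNorm (L * D⁻¹) * ‖D * X‖ * (√2 - 1 + w) := by gcongr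
    _ = specNorm (L * D⁻¹) * (‖D * X‖ * (√2 - 1 + w)) := by ring
    _ ≤ specNorm (L * D⁻¹) * (√2 * (specNorm (D * B) * ‖B‖ * ε)) := by gcongr
    _ = _ := by ring

end GeneralizedCholesky

theorem stmt16 (m n : ℕ) (K dK Lt dL D : Matrix (Fin (m + n)) (Fin (m + n)) ℝ) (ε : ℝ)
    (hK : Kᵀ = K) (hdK : dKᵀ = dK) (hε : 0 ≤ ε)
    (hLt : IsLowerTri Lt) (hLtd : PosDiag Lt)
    (hfact : K + dK = Lt * Jmat m n * Ltᵀ)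
    (hbound : ∀ i j, |dK i j| ≤ ε * (entAbs Lt * entAbs Ltᵀ) i j)
    (hsmall : condF Lt * condF (Lt⁻¹ᵀ) * ε < 1 / 2)
    (hL' : IsLowerTri (Lt - dL)) (hL'd : PosDiag (Lt - dL))
    (hfact' : K = (Lt - dL) * Jmat m n * (Lt - dL)ᵀ)
    (hD : D.IsDiag) (hDpos : ∀ i, 0 < D i i) :
    frobNorm dL ≤
      Real.sqrt 2 * specNorm (Lt * D⁻¹) * specNorm (D * entAbs Lt⁻¹ * entAbs Lt) *
        condF Lt * ε /
        (Real.sqrt 2 - 1 + Real.sqrt (1 - 2 * condF Lt * condF (Lt⁻¹ᵀ) * ε)) := by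
  have hs : ∀ i : Fin (m + n), (if (i : ℕ) < m then (1 : ℝ) else -1) ^ 2 = 1 := by
    intro i
    split_ifs <;> norm_num
  rw [condF_inv_transpose (hLt.isUnit_det hLtd)] at hsmall ⊢
  have h := norm_generalizedCholesky_perturbation_le hs hdK hε hLt hLtd hfact hbound hsmall
    hL' hL'd hfact' hDpos
  have hDdiag : Matrix.diagonal (fun i => D i i) = D := hD.diagonal_diag
  rw [hDdiag, ← Matrix.mul_assoc, ← mul_assoc 2, ← mul_assoc 2] at h
  exact h
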